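/- Let d_0 be the unique positive real with Σ_{i=1}^N s_i^{d_0} = 1, and take the weights t_i := s_i^{d_0} (so ν is the natural self-similar measure on E). Assume (f_i)_{i=1}^N satisfies the open set condition. Then the quantization dimension of μ of order r exists and equals d_0, and 0 < liminf_{n→∞} n^{1/d_0} e_{n,r}(μ) ≤ limsup_{n→∞} n^{1/d_0} e_{n,r}(μ) < ∞. -/

import Mathlib

open MeasureTheory Filter

/-- The `n`-th quantization error of order `r` of a Borel measure `P` on `ℝ^q`:
the infimum of `(∫ d(x,α)^r dP)^{1/r}` over finite sets `α` with `1 ≤ card α ≤ n`. -/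
noncomputable def quantErr {q : ℕ} (P : Measure (EuclideanSpace ℝ (Fin q)))
    (n : ℕ) (r : ℝ) : ℝ :=
  sInf ((fun α : Finset (EuclideanSpace ℝ (Fin q)) =>
      (∫ x, Metric.infDist x (α : Set (EuclideanSpace ℝ (Fin q))) ^ r ∂P) ^ (1 / r)) ''
    {α : Finset (EuclideanSpace ℝ (Fin q)) | α.Nonempty ∧ α.card ≤ n})

/-- Product of weights `g` along a word `σ` (equals `1` for the empty word). -/
noncomputable def prodw {N : ℕ} (g : Fin N → ℝ) (σ : List (Fin N)) : ℝ := (σ.map g).prod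

/-- The composition `f_{σ_1} ∘ ⋯ ∘ f_{σ_n}` along a word `σ`. -/
def wordMap {q N : ℕ} (f : Fin N → EuclideanSpace ℝ (Fin q) → EuclideanSpace ℝ (Fin q))
    (σ : List (Fin N)) : EuclideanSpace ℝ (Fin q) → EuclideanSpace ℝ (Fin q) :=
  σ.foldr (fun i g => f i ∘ g) id

/-- `h(σ) = h^{(1)}(σ) + h^{(2)}(σ)` where
`h^{(1)}(σ) = Σ_{j=0}^{|σ|-1} p0 p_{σ|_j} t_{σ^{(l)}_{-j}} s_σ^r` and `h^{(2)}(σ) = p_σ s_σ^r`. -/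
noncomputable def hfun {N : ℕ} (r p0 : ℝ) (s t p : Fin N → ℝ) (σ : List (Fin N)) : ℝ :=
  (∑ j ∈ Finset.range σ.length, p0 * prodw p (σ.take j) * prodw t (σ.drop j)) * prodw s σ ^ r
    + prodw p σ * prodw s σ ^ r

/-- `η̲_r := min_{1 ≤ i ≤ N} min{p0 t_i + p_i, t_i} · s_i^r`. -/
noncomputable def etaLow {N : ℕ} (r p0 : ℝ) (s t p : Fin N → ℝ) : ℝ :=
  ⨅ i, min (p0 * t i + p i) (t i) * s i ^ r

/-- The finite maximal antichain `Λ_{k,r} = {σ : h(σ|_{|σ|-1}) ≥ η̲_r/k > h(σ)}`. -/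
def Lam {N : ℕ} (r p0 : ℝ) (s t p : Fin N → ℝ) (k : ℕ) : Set (List (Fin N)) :=
  {σ | σ ≠ [] ∧ etaLow r p0 s t p / k ≤ hfun r p0 s t p σ.dropLast ∧
    hfun r p0 s t p σ < etaLow r p0 s t p / k}

/-- `a(x) = Σ_i (t_i s_i^r)^{x/(x+r)}` (also used for `b` with `p` in place of `t`). -/
noncomputable def afun {N : ℕ} (r : ℝ) (s t : Fin N → ℝ) (x : ℝ) : ℝ :=
  ∑ i, (t i * s i ^ r) ^ (x / (x + r))

theorem surjective_of_dist_eq_mul {F : Type*} [NormedAddCommGroup F] [InnerProductSpace ℝ F]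
    [FiniteDimensional ℝ F] {g : F → F} {c : ℝ} (hc : 0 < c)
    (hg : ∀ x y, dist (g x) (g y) = c * dist x y) : Function.Surjective g := by
  have hiso : Isometry fun x => c⁻¹ • g x := by
    refine Isometry.of_dist_eq fun x y => ?_
    rw [dist_smul₀, hg, Real.norm_of_nonneg (inv_nonneg.2 hc.le), inv_mul_cancel_left₀ hc.ne']
  let A : F →ᵃⁱ[ℝ] F := hiso.affineIsometryOfStrictConvexSpace
  have hA : Function.Surjective A.toAffineMap := by
    rw [← AffineMap.linear_surjective_iff, ← LinearMap.injective_iff_surjective,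
      AffineMap.linear_injective_iff]
    exact A.injective
  intro y
  obtain ⟨x, hx⟩ := hA (c⁻¹ • y)
  have hx' : c⁻¹ • g x = c⁻¹ • y := hx
  exact ⟨x, smul_right_injective F (inv_ne_zero hc.ne') hx'⟩

theorem prodw_cons {N : ℕ} (g : Fin N → ℝ) (i : Fin N) (σ : List (Fin N)) :
    prodw g (i :: σ) = g i * prodw g σ := by
  simp [prodw]

theorem prodw_pos {N : ℕ} {g : Fin N → ℝ} (hg : ∀ i, 0 < g i) (σ : List (Fin N)) :
    0 < prodw g σ := by
  induction σ with
  | nil => simp [prodw]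
  | cons i σ ih => rw [prodw_cons]; exact mul_pos (hg i) ih

theorem wordMap_cons {q N : ℕ}
    (f : Fin N → EuclideanSpace ℝ (Fin q) → EuclideanSpace ℝ (Fin q))
    (i : Fin N) (σ : List (Fin N)) : wordMap f (i :: σ) = f i ∘ wordMap f σ := rfl

theorem dist_wordMap {q N : ℕ}
    {f : Fin N → EuclideanSpace ℝ (Fin q) → EuclideanSpace ℝ (Fin q)} {s : Fin N → ℝ}
    (hf : ∀ i x y, dist (f i x) (f i y) = s i * dist x y) (σ : List (Fin N))
    (x y : EuclideanSpace ℝ (Fin q)) :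
    dist (wordMap f σ x) (wordMap f σ y) = prodw s σ * dist x y := by
  induction σ with
  | nil => simp [prodw, wordMap]
  | cons i σ ih => rw [prodw_cons, wordMap_cons, Function.comp, Function.comp, hf, ih, mul_assoc]

theorem continuous_of_dist_eq_mul {X : Type*} [PseudoMetricSpace X] {g : X → X} {c : ℝ}
    (hg : ∀ x y, dist (g x) (g y) = c * dist x y) : Continuous g :=
  (LipschitzWith.of_dist_le_mul (K := c.toNNReal) fun x y => by
    rw [hg]
    exact mul_le_mul_of_nonneg_right (Real.le_coe_toNNReal c) dist_nonneg).continuous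

/-- A compactly supported measure satisfying an (in-)homogeneous self-similarity equation whose
inhomogeneous term lives on the closed forward-invariant set `E` lives on `E` itself. -/
theorem measure_compl_eq_zero_of_selfSimilar {X : Type*} [PseudoMetricSpace X]
    [MeasurableSpace X] [BorelSpace X] {ι : Type*} [Fintype ι] [Nonempty ι]
    {f : ι → X → X} {s p : ι → ℝ} (hs : ∀ i, s i ∈ Set.Ioo (0 : ℝ) 1)
    (hf : ∀ i x y, dist (f i x) (f i y) = s i * dist x y)
    {E : Set X} (hEc : IsClosed E) (hEne : E.Nonempty) (hE : ∀ i, Set.MapsTo (f i) E E)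
    (hp : ∀ i, 0 < p i) (hp1 : ∑ i, p i ≤ 1)
    {m₀ m : Measure X} [IsFiniteMeasure m] (hm₀ : m₀ Eᶜ = 0)
    (hm : ∃ K, IsCompact K ∧ m Kᶜ = 0)
    (hmss : m = m₀ + ∑ i, ENNReal.ofReal (p i) • m.map (f i)) : m Eᶜ = 0 := by
  set g : X → ENNReal := fun x => ENNReal.ofReal (Metric.infDist x E) with hgdef
  have hgm : Measurable g := (Metric.continuous_infDist_pt E).measurable.ennreal_ofReal
  have hg0 : ∀ x, g x = 0 ↔ x ∈ E := by
    intro x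
    rw [hgdef, ENNReal.ofReal_eq_zero, hEc.mem_iff_infDist_zero hEne]
    exact ⟨fun h => le_antisymm h Metric.infDist_nonneg, fun h => h.le⟩
  have hgf : ∀ i x, g (f i x) ≤ ENNReal.ofReal (s i) * g x := by
    intro i x
    simp only [hgdef]
    rw [← ENNReal.ofReal_mul (hs i).1.le]
    refine ENNReal.ofReal_le_ofReal ?_
    rw [← div_le_iff₀' (hs i).1, Metric.le_infDist hEne]
    intro y hy
    rw [div_le_iff₀' (hs i).1, ← hf]
    exact Metric.infDist_le_dist_of_mem (hE i hy)
  have hfin : ∫⁻ x, g x ∂m ≠ ⊤ := by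
    obtain ⟨K, hK, hmK⟩ := hm
    obtain ⟨R, hR⟩ := hK.bddAbove_image (Metric.continuous_infDist_pt E).continuousOn
    have hae : ∀ᵐ x ∂m, g x ≤ ENNReal.ofReal R := by
      have : ∀ᵐ x ∂m, x ∈ K := by rw [ae_iff]; exact hmK
      filter_upwards [this] with x hx
      exact ENNReal.ofReal_le_ofReal (hR ⟨x, hx, rfl⟩)
    refine ((lintegral_mono_ae hae).trans_lt ?_).ne
    rw [lintegral_const]
    exact ENNReal.mul_lt_top ENNReal.ofReal_lt_top (measure_lt_top _ _)
  have hm₀g : ∫⁻ x, g x ∂m₀ = 0 := by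
    rw [lintegral_eq_zero_iff hgm, Filter.EventuallyEq, ae_iff]
    simp only [Pi.zero_apply, hg0]
    exact hm₀
  have hcontr : ∫⁻ x, g x ∂m ≤ (∑ i, ENNReal.ofReal (p i) * ENNReal.ofReal (s i)) *
      ∫⁻ x, g x ∂m := by
    conv_lhs => rw [hmss]
    rw [lintegral_add_measure, hm₀g, zero_add, lintegral_finsetSum_measure, Finset.sum_mul]
    refine Finset.sum_le_sum fun i _ => ?_
    rw [lintegral_smul_measure, smul_eq_mul,
      lintegral_map hgm (continuous_of_dist_eq_mul (hf i)).measurable, mul_assoc]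
    gcongr
    rw [← lintegral_const_mul _ hgm]
    exact lintegral_mono (hgf i)
  have hc : ∑ i, ENNReal.ofReal (p i) * ENNReal.ofReal (s i) < 1 := by
    calc ∑ i, ENNReal.ofReal (p i) * ENNReal.ofReal (s i)
        < ∑ i, ENNReal.ofReal (p i) := by
          refine ENNReal.sum_lt_sum_of_nonempty Finset.univ_nonempty fun i _ => ?_
          have : ENNReal.ofReal (s i) < 1 := by
            rw [ENNReal.ofReal_lt_one]; exact (hs i).2
          calc ENNReal.ofReal (p i) * ENNReal.ofReal (s i) < ENNReal.ofReal (p i) * 1 :=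
                ENNReal.mul_lt_mul_right (by simpa using hp i) ENNReal.ofReal_ne_top this
            _ = _ := mul_one _
      _ = ENNReal.ofReal (∑ i, p i) := (ENNReal.ofReal_sum_of_nonneg fun i _ => (hp i).le).symm
      _ ≤ 1 := by rw [ENNReal.ofReal_le_one]; exact hp1
  have hzero : ∫⁻ x, g x ∂m = 0 := by
    by_contra h
    have := ENNReal.mul_lt_mul_left h hfin hc
    rw [one_mul] at this
    exact absurd hcontr (not_le.2 this)
  rw [lintegral_eq_zero_iff hgm, Filter.EventuallyEq, ae_iff] at hzero
  simp only [Pi.zero_apply, hg0] at hzero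
  exact hzero

/-- Packing bound: the number of `ρδ`-separated points in a ball of radius `Rδ` is bounded
independently of the scale `δ`. -/
theorem exists_card_le_of_separated (F : Type*) [NormedAddCommGroup F] [NormedSpace ℝ F]
    [FiniteDimensional ℝ F] (R : ℝ) {ρ : ℝ} (hρ : 0 < ρ) :
    ∃ M : ℕ, ∀ (ι : Type) (W : Finset ι) (y : ι → F) (x : F) (δ : ℝ), 0 < δ →
      (∀ i ∈ W, dist (y i) x ≤ R * δ) →
      (∀ i ∈ W, ∀ j ∈ W, i ≠ j → ρ * δ ≤ dist (y i) (y j)) → W.card ≤ M := by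
  classical
  have : ProperSpace F := FiniteDimensional.proper ℝ F
  obtain ⟨t, -, htf, htc⟩ := (isCompact_closedBall (0 : F) R).finite_cover_balls (half_pos hρ)
  refine ⟨htf.toFinset.card, fun ι W y x δ hδ hball hsep => ?_⟩
  have hmem : ∀ i ∈ W, ∃ z ∈ t, dist (δ⁻¹ • (y i - x)) z < ρ / 2 := by
    intro i hi
    have : δ⁻¹ • (y i - x) ∈ Metric.closedBall (0 : F) R := by
      rw [mem_closedBall_zero_iff, norm_smul, norm_inv, Real.norm_of_nonneg hδ.le,
        ← dist_eq_norm, inv_mul_le_iff₀ hδ, mul_comm]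
      exact hball i hi
    simpa using htc this
  choose! z hzt hz using hmem
  refine Finset.card_le_card_of_injOn z (fun i hi => by simpa using hzt i hi) ?_
  intro i hi j hj hij
  by_contra hne
  have h1 : dist (δ⁻¹ • (y i - x)) (δ⁻¹ • (y j - x)) < ρ := by
    have hi' := hz i hi
    have hj' := hz j hj
    rw [← hij, dist_comm] at hj'
    linarith [dist_triangle (δ⁻¹ • (y i - x)) (z i) (δ⁻¹ • (y j - x))]
  rw [dist_smul₀, dist_sub_right, norm_inv, Real.norm_of_nonneg hδ.le, inv_mul_lt_iff₀ hδ,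
    mul_comm] at h1
  exact absurd (hsep i hi j hj hne) (not_le.2 h1)

/-- Cross-cuts of the word tree at scale `ε`: a finite set of words whose contraction ratios are
comparable to `ε`, such that the corresponding pieces cover `E`, decompose `ν`, and have pairwise
disjoint images of `U`. -/
theorem exists_crosscut {q N : ℕ} (hN : 0 < N)
    {f : Fin N → EuclideanSpace ℝ (Fin q) → EuclideanSpace ℝ (Fin q)}
    {s : Fin N → ℝ} (hs : ∀ i, s i ∈ Set.Ioo (0 : ℝ) 1)
    (hf : ∀ i x y, dist (f i x) (f i y) = s i * dist x y)
    {E U : Set (EuclideanSpace ℝ (Fin q))} (hE : E ⊆ ⋃ i, f i '' E)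
    (hU : ∀ i, f i '' U ⊆ U) (hUd : Pairwise fun i j => Disjoint (f i '' U) (f j '' U))
    {d : ℝ} (hd : ∑ i, s i ^ d = 1)
    {ν : Measure (EuclideanSpace ℝ (Fin q))}
    (hν : ν = ∑ i, ENNReal.ofReal (s i ^ d) • ν.map (f i))
    {c : ℝ} (hc : 0 < c) (hcs : ∀ i, c ≤ s i) {ε : ℝ} (hε : 0 < ε) (hε1 : c * ε ≤ 1) :
    ∃ W : Finset (List (Fin N)),
      (∀ σ ∈ W, c * ε ≤ prodw s σ ∧ prodw s σ ≤ ε) ∧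
      ∑ σ ∈ W, prodw s σ ^ d = 1 ∧
      (∀ A, MeasurableSet A →
        ν A = ∑ σ ∈ W, ENNReal.ofReal (prodw s σ ^ d) * ν (wordMap f σ ⁻¹' A)) ∧
      (∀ x ∈ E, ∃ σ ∈ W, x ∈ wordMap f σ '' E) ∧
      (∀ σ ∈ W, wordMap f σ '' U ⊆ U) ∧
      ∀ σ ∈ W, ∀ τ ∈ W, σ ≠ τ → Disjoint (wordMap f σ '' U) (wordMap f τ '' U) := by
  classical
  have : Nonempty (Fin N) := ⟨⟨0, hN⟩⟩
  obtain ⟨i₀, hi₀⟩ := Finite.exists_max s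
  set b := s i₀
  obtain ⟨n, hn⟩ : ∃ n : ℕ, b ^ n ≤ ε :=
    (exists_pow_lt_of_lt_one hε (hs i₀).2).imp fun _ h => h.le
  induction n generalizing ε with
  | zero =>
    refine ⟨{[]}, ?_⟩
    simp only [pow_zero] at hn
    simp [prodw, wordMap, hε1, hn]
  | succ n ih =>
    rcases le_or_gt 1 ε with h1 | h1
    · refine ⟨{[]}, ?_⟩
      simp [prodw, wordMap, hε1, h1]
    · have hstep : ∀ i, 0 < ε / s i ∧ c * (ε / s i) ≤ 1 ∧ b ^ n ≤ ε / s i := by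
        intro i
        have hi := (hs i).1
        refine ⟨div_pos hε hi, ?_, ?_⟩
        · rw [← mul_div_assoc, div_le_one hi]
          nlinarith [hcs i]
        · rw [le_div_iff₀ hi]
          refine le_trans ?_ hn
          rw [pow_succ]
          exact mul_le_mul_of_nonneg_left (hi₀ i) (pow_nonneg (hs i₀).1.le n)
      choose W hWb hWs hWν hWE hWU hWd using
        fun i => ih (hstep i).1 (hstep i).2.1 (hstep i).2.2
      have hinj : ∀ i, Function.Injective (f i) := fun i x y hxy => by
        have := hf i x y
        rw [hxy, dist_self, eq_comm, mul_eq_zero] at this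
        exact dist_eq_zero.1 (this.resolve_left (hs i).1.ne')
      have hcons : ∀ i : Fin N, Set.InjOn (List.cons i) (W i : Set (List (Fin N))) :=
        fun i => List.cons_injective.injOn
      have hdisj : ((Finset.univ : Finset (Fin N)) : Set (Fin N)).PairwiseDisjoint
          fun i => (W i).image (List.cons i) := by
        intro i _ j _ hij
        rw [Function.onFun, Finset.disjoint_left]
        intro σ hσ hσ'
        obtain ⟨a, -, rfl⟩ := Finset.mem_image.1 hσ
        obtain ⟨a', -, h⟩ := Finset.mem_image.1 hσ'
        exact hij (List.cons.inj h).1.symm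
      have hmem : ∀ σ, σ ∈ Finset.univ.biUnion (fun i => (W i).image (List.cons i)) ↔
          ∃ i, ∃ τ ∈ W i, i :: τ = σ := by
        intro σ
        simp
      refine ⟨Finset.univ.biUnion fun i => (W i).image (List.cons i), ?_, ?_, ?_, ?_, ?_, ?_⟩
      · intro σ hσ
        obtain ⟨i, τ, hτ, rfl⟩ := (hmem σ).1 hσ
        have hi := (hs i).1
        obtain ⟨h1, h2⟩ := hWb i τ hτ
        rw [prodw_cons]
        rw [← mul_div_assoc, div_le_iff₀' hi] at h1
        rw [le_div_iff₀' hi] at h2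
        exact ⟨h1, h2⟩
      · rw [Finset.sum_biUnion hdisj, ← hd]
        refine Finset.sum_congr rfl fun i _ => ?_
        rw [Finset.sum_image (hcons i)]
        simp_rw [prodw_cons]
        rw [← mul_one (s i ^ d), ← hWs i, Finset.mul_sum]
        exact Finset.sum_congr rfl fun τ _ =>
          Real.mul_rpow (hs i).1.le (prodw_pos (fun j => (hs j).1) τ).le
      · intro A hA
        rw [Finset.sum_biUnion hdisj]
        conv_lhs => rw [hν]
        rw [Measure.finsetSum_apply]
        refine Finset.sum_congr rfl fun i _ => ?_
        have hfi : Measurable (f i) := (continuous_of_dist_eq_mul (hf i)).measurable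
        rw [Finset.sum_image (hcons i), Measure.smul_apply, Measure.map_apply hfi hA,
          hWν i _ (hfi hA), smul_eq_mul, Finset.mul_sum]
        refine Finset.sum_congr rfl fun τ _ => ?_
        rw [prodw_cons, Real.mul_rpow (hs i).1.le (prodw_pos (fun j => (hs j).1) τ).le,
          ENNReal.ofReal_mul (Real.rpow_nonneg (hs i).1.le d), mul_assoc, wordMap_cons,
          Set.preimage_comp]
      · intro x hx
        obtain ⟨i, y, hy, rfl⟩ := Set.mem_iUnion.1 (hE hx)
        obtain ⟨τ, hτ, z, hz, rfl⟩ := hWE i y hy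
        exact ⟨i :: τ, (hmem _).2 ⟨i, τ, hτ, rfl⟩, z, hz, rfl⟩
      · intro σ hσ
        obtain ⟨i, τ, hτ, rfl⟩ := (hmem σ).1 hσ
        rw [wordMap_cons, Set.image_comp]
        exact (Set.image_mono (hWU i τ hτ)).trans (hU i)
      · intro σ hσ σ' hσ' hne
        obtain ⟨i, τ, hτ, rfl⟩ := (hmem σ).1 hσ
        obtain ⟨j, τ', hτ', rfl⟩ := (hmem σ').1 hσ'
        rw [wordMap_cons, wordMap_cons, Set.image_comp, Set.image_comp]
        by_cases hij : i = j
        · subst hij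
          rw [Set.disjoint_image_iff (hinj i)]
          exact hWd i τ hτ τ' hτ' fun h => hne (by rw [h])
        · exact (hUd hij).mono (Set.image_mono (hWU i τ hτ)) (Set.image_mono (hWU j τ' hτ'))

/-- Under the open set condition the natural self-similar measure is upper `d`-regular. -/
theorem exists_measure_closedBall_le {q N : ℕ} (hN : 0 < N)
    {f : Fin N → EuclideanSpace ℝ (Fin q) → EuclideanSpace ℝ (Fin q)}
    {s : Fin N → ℝ} (hs : ∀ i, s i ∈ Set.Ioo (0 : ℝ) 1)
    (hf : ∀ i x y, dist (f i x) (f i y) = s i * dist x y)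
    {E U : Set (EuclideanSpace ℝ (Fin q))} (hEcpt : IsCompact E) (hE : E ⊆ ⋃ i, f i '' E)
    (hUne : U.Nonempty) (hUo : IsOpen U)
    (hU : ∀ i, f i '' U ⊆ U) (hUd : Pairwise fun i j => Disjoint (f i '' U) (f j '' U))
    {d : ℝ} (hd0 : 0 < d) (hd : ∑ i, s i ^ d = 1)
    {ν : Measure (EuclideanSpace ℝ (Fin q))} [IsProbabilityMeasure ν] (hνE : ν Eᶜ = 0)
    (hν : ν = ∑ i, ENNReal.ofReal (s i ^ d) • ν.map (f i)) :
    ∃ M : ℕ, ∀ x δ, 0 < δ → δ ≤ 1 →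
      ν (Metric.closedBall x δ) ≤ ENNReal.ofReal (M * δ ^ d) := by
  classical
  have : Nonempty (Fin N) := ⟨⟨0, hN⟩⟩
  obtain ⟨i₀, hi₀⟩ := Finite.exists_min s
  set c := s i₀
  have hc : 0 < c := (hs i₀).1
  obtain ⟨u, hu⟩ := hUne
  obtain ⟨a, ha, haU⟩ := Metric.isOpen_iff.1 hUo u hu
  obtain ⟨D, hD⟩ := hEcpt.isBounded.subset_closedBall u
  obtain ⟨M, hM⟩ := exists_card_le_of_separated (EuclideanSpace ℝ (Fin q)) (D + 1)
    (mul_pos hc ha)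
  refine ⟨M, fun x δ hδ hδ1 => ?_⟩
  obtain ⟨W, hWb, -, hWν, -, -, hWd⟩ := exists_crosscut hN hs hf hE hU hUd hd hν hc hi₀ hδ
    (mul_le_one₀ (hs i₀).2.le hδ.le hδ1)
  set V := W.filter fun σ => (E ∩ wordMap f σ ⁻¹' Metric.closedBall x δ).Nonempty with hV
  have hpos := prodw_pos (fun j => (hs j).1)
  have hcard : V.card ≤ M := by
    refine hM _ V (fun σ => wordMap f σ u) x δ hδ ?_ ?_
    · intro σ hσ
      obtain ⟨hσW, e, heE, heB⟩ := Finset.mem_filter.1 hσ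
      have h1 : dist (wordMap f σ u) (wordMap f σ e) ≤ δ * D := by
        rw [dist_wordMap hf, dist_comm]
        exact mul_le_mul (hWb σ hσW).2 (hD heE) dist_nonneg hδ.le
      have h2 : dist (wordMap f σ e) x ≤ δ := heB
      linarith [dist_triangle (wordMap f σ u) (wordMap f σ e) x]
    · intro σ hσ τ hτ hne
      have hσW := (Finset.mem_filter.1 hσ).1
      have hτW := (Finset.mem_filter.1 hτ).1
      by_contra! hlt
      obtain ⟨z, hz⟩ := surjective_of_dist_eq_mul (hpos σ) (dist_wordMap hf σ) (wordMap f τ u)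
      have hlt' : prodw s σ * dist u z < prodw s σ * a := by
        rw [← dist_wordMap hf, hz]
        refine hlt.trans_le ?_
        nlinarith [(hWb σ hσW).1]
      have hzU : z ∈ U := haU (by
        rw [Metric.mem_ball, dist_comm]
        exact lt_of_mul_lt_mul_left hlt' (hpos σ).le)
      exact Set.disjoint_left.1 (hWd σ hσW τ hτW hne) ⟨z, hzU, hz⟩ ⟨u, hu, rfl⟩
  rw [hWν _ Metric.isClosed_closedBall.measurableSet, ← Finset.sum_filter_add_sum_filter_not W
    fun σ => (E ∩ wordMap f σ ⁻¹' Metric.closedBall x δ).Nonempty, ← hV]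
  have hz : ∑ σ ∈ W with ¬(E ∩ wordMap f σ ⁻¹' Metric.closedBall x δ).Nonempty,
      ENNReal.ofReal (prodw s σ ^ d) * ν (wordMap f σ ⁻¹' Metric.closedBall x δ) = 0 := by
    refine Finset.sum_eq_zero fun σ hσ => ?_
    have hsub : wordMap f σ ⁻¹' Metric.closedBall x δ ⊆ Eᶜ :=
      fun z hzB hzE => (Finset.mem_filter.1 hσ).2 ⟨z, hzE, hzB⟩
    rw [measure_mono_null hsub hνE, mul_zero]
  rw [hz, add_zero]
  calc ∑ σ ∈ V, ENNReal.ofReal (prodw s σ ^ d) * ν (wordMap f σ ⁻¹' Metric.closedBall x δ)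
      ≤ ∑ σ ∈ V, ENNReal.ofReal (δ ^ d) := by
        refine Finset.sum_le_sum fun σ hσ => ?_
        refine (mul_le_of_le_one_right' prob_le_one).trans (ENNReal.ofReal_le_ofReal ?_)
        exact Real.rpow_le_rpow (hpos σ).le (hWb σ (Finset.mem_filter.1 hσ).1).2 hd0.le
    _ = ENNReal.ofReal (V.card * δ ^ d) := by
        rw [Finset.sum_const, nsmul_eq_mul, ENNReal.ofReal_mul (Nat.cast_nonneg _),
          ENNReal.ofReal_natCast]
    _ ≤ ENNReal.ofReal (M * δ ^ d) := by
        refine ENNReal.ofReal_le_ofReal ?_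
        have : (V.card : ℝ) ≤ M := by exact_mod_cast hcard
        gcongr

theorem integrable_infDist_rpow {q : ℕ} {P : Measure (EuclideanSpace ℝ (Fin q))}
    [IsFiniteMeasure P] {E : Set (EuclideanSpace ℝ (Fin q))} (hE : IsCompact E) (hPE : P Eᶜ = 0)
    {r : ℝ} (hr : 0 < r) (α : Set (EuclideanSpace ℝ (Fin q))) :
    Integrable (fun x => Metric.infDist x α ^ r) P := by
  have hcont : Continuous fun x => Metric.infDist x α ^ r :=
    (Metric.continuous_infDist_pt α).rpow_const fun _ => Or.inr hr.le
  obtain ⟨R, hR⟩ := hE.bddAbove_image hcont.continuousOn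
  refine Integrable.of_bound hcont.aestronglyMeasurable R ?_
  have : ∀ᵐ x ∂P, x ∈ E := by rw [ae_iff]; exact hPE
  filter_upwards [this] with x hx
  rw [Real.norm_of_nonneg (Real.rpow_nonneg Metric.infDist_nonneg r)]
  exact hR ⟨x, hx, rfl⟩

/-- Covering upper bound for the quantization error. -/
theorem quantErr_le_of_cover {q : ℕ} {P : Measure (EuclideanSpace ℝ (Fin q))}
    [IsProbabilityMeasure P] {E : Set (EuclideanSpace ℝ (Fin q))} (hPE : P Eᶜ = 0)
    {r : ℝ} (hr : 0 < r) {n : ℕ} {α : Finset (EuclideanSpace ℝ (Fin q))} (hα : α.Nonempty)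
    (hαn : α.card ≤ n) {ε : ℝ} (hε : 0 ≤ ε) (hcov : ∀ x ∈ E, ∃ y ∈ α, dist x y ≤ ε) :
    quantErr P n r ≤ ε := by
  have hbdd : BddBelow ((fun α : Finset (EuclideanSpace ℝ (Fin q)) =>
      (∫ x, Metric.infDist x (α : Set (EuclideanSpace ℝ (Fin q))) ^ r ∂P) ^ (1 / r)) ''
      {α : Finset (EuclideanSpace ℝ (Fin q)) | α.Nonempty ∧ α.card ≤ n}) := by
    refine ⟨0, ?_⟩
    rintro _ ⟨β, -, rfl⟩
    exact Real.rpow_nonneg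
      (integral_nonneg fun x => Real.rpow_nonneg Metric.infDist_nonneg r) _
  refine (csInf_le hbdd ⟨α, ⟨hα, hαn⟩, rfl⟩).trans ?_
  have hint : ∫ x, Metric.infDist x (α : Set (EuclideanSpace ℝ (Fin q))) ^ r ∂P ≤ ε ^ r := by
    have hae : ∀ᵐ x ∂P, Metric.infDist x (α : Set (EuclideanSpace ℝ (Fin q))) ^ r ≤ ε ^ r := by
      have : ∀ᵐ x ∂P, x ∈ E := by rw [ae_iff]; exact hPE
      filter_upwards [this] with x hx
      obtain ⟨y, hy, hxy⟩ := hcov x hx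
      exact Real.rpow_le_rpow Metric.infDist_nonneg
        ((Metric.infDist_le_dist_of_mem (Finset.mem_coe.2 hy)).trans hxy) hr.le
    calc _ ≤ ∫ _, ε ^ r ∂P := integral_mono_of_nonneg
          (.of_forall fun x => Real.rpow_nonneg Metric.infDist_nonneg r)
          (integrable_const _) hae
      _ = ε ^ r := by simp
  calc _ ≤ (ε ^ r) ^ (1 / r) := Real.rpow_le_rpow
        (integral_nonneg fun x => Real.rpow_nonneg Metric.infDist_nonneg r) hint (by positivity)
    _ = ε := by rw [← Real.rpow_mul hε, mul_one_div_cancel hr.ne', Real.rpow_one]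

/-- Lower bound for the quantization error of `P` when every `n`-point set misses, up to
distance `δ`, a set of `P`-mass at least `w`. -/
theorem le_quantErr {q : ℕ} {P : Measure (EuclideanSpace ℝ (Fin q))}
    [IsFiniteMeasure P] {E : Set (EuclideanSpace ℝ (Fin q))} (hE : IsCompact E)
    (hPE : P Eᶜ = 0) {r : ℝ} (hr : 0 < r) {n : ℕ} (hn : 1 ≤ n) {δ w : ℝ} (hδ : 0 ≤ δ)
    (hw : 0 ≤ w)
    (hP : ∀ α : Finset (EuclideanSpace ℝ (Fin q)), α.Nonempty → α.card ≤ n →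
      w ≤ P.real {x | δ ≤ Metric.infDist x (α : Set (EuclideanSpace ℝ (Fin q)))}) :
    δ * w ^ (1 / r) ≤ quantErr P n r := by
  refine le_csInf ⟨_, {0}, ⟨Finset.singleton_nonempty 0, by simpa using hn⟩, rfl⟩ ?_
  rintro _ ⟨α, ⟨hα, hαn⟩, rfl⟩
  have hmarkov := mul_meas_ge_le_integral_of_nonneg
    (.of_forall fun x => Real.rpow_nonneg Metric.infDist_nonneg r)
    (integrable_infDist_rpow hE hPE hr (α : Set (EuclideanSpace ℝ (Fin q)))) (δ ^ r)
  have hsub : P.real {x | δ ≤ Metric.infDist x (α : Set (EuclideanSpace ℝ (Fin q)))} ≤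
      P.real {x | δ ^ r ≤ Metric.infDist x (α : Set (EuclideanSpace ℝ (Fin q))) ^ r} :=
    measureReal_mono fun x hx => Real.rpow_le_rpow hδ hx hr.le
  have hδr : 0 ≤ δ ^ r := Real.rpow_nonneg hδ r
  have hle : δ ^ r * w ≤ ∫ x, Metric.infDist x (α : Set (EuclideanSpace ℝ (Fin q))) ^ r ∂P :=
    (mul_le_mul_of_nonneg_left ((hP α hα hαn).trans hsub) hδr).trans hmarkov
  calc δ * w ^ (1 / r) = (δ ^ r * w) ^ (1 / r) := by
        rw [Real.mul_rpow hδr hw, ← Real.rpow_mul hδ, mul_one_div_cancel hr.ne', Real.rpow_one]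
    _ ≤ _ := Real.rpow_le_rpow (mul_nonneg hδr hw) hle (by positivity)

theorem exists_quantErr_le {q N : ℕ} (hN : 0 < N)
    {f : Fin N → EuclideanSpace ℝ (Fin q) → EuclideanSpace ℝ (Fin q)}
    {s : Fin N → ℝ} (hs : ∀ i, s i ∈ Set.Ioo (0 : ℝ) 1)
    (hf : ∀ i x y, dist (f i x) (f i y) = s i * dist x y)
    {E U : Set (EuclideanSpace ℝ (Fin q))} (hEcpt : IsCompact E) (hEne : E.Nonempty)
    (hE : E ⊆ ⋃ i, f i '' E) (hEdiam : Metric.diam E ≤ 1)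
    (hU : ∀ i, f i '' U ⊆ U) (hUd : Pairwise fun i j => Disjoint (f i '' U) (f j '' U))
    {d : ℝ} (hd0 : 0 < d) (hd : ∑ i, s i ^ d = 1)
    {ν : Measure (EuclideanSpace ℝ (Fin q))}
    (hν : ν = ∑ i, ENNReal.ofReal (s i ^ d) • ν.map (f i))
    {P : Measure (EuclideanSpace ℝ (Fin q))} [IsProbabilityMeasure P] (hPE : P Eᶜ = 0)
    {r : ℝ} (hr : 0 < r) :
    ∃ C : ℝ, 0 < C ∧ ∀ n : ℕ, 1 ≤ n → (n : ℝ) ^ (1 / d) * quantErr P n r ≤ C := by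
  classical
  have : Nonempty (Fin N) := ⟨⟨0, hN⟩⟩
  obtain ⟨i₀, hi₀⟩ := Finite.exists_min s
  set c := s i₀
  have hc : 0 < c := (hs i₀).1
  obtain ⟨e, he⟩ := hEne
  refine ⟨c⁻¹, inv_pos.2 hc, fun n hn => ?_⟩
  have hn' : (1 : ℝ) ≤ n := by exact_mod_cast hn
  have hn0 : (0 : ℝ) < n := by linarith
  set ε : ℝ := c⁻¹ * (n : ℝ) ^ (-(1 / d)) with hεdef
  have hnd : 0 < (n : ℝ) ^ (-(1 / d)) := Real.rpow_pos_of_pos hn0 _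
  have hε : 0 < ε := mul_pos (inv_pos.2 hc) hnd
  have hcε : c * ε = (n : ℝ) ^ (-(1 / d)) := mul_inv_cancel_left₀ hc.ne' _
  obtain ⟨W, hWb, hWs, -, hWE, -, -⟩ := exists_crosscut hN hs hf hE hU hUd hd hν hc hi₀ hε (by
    rw [hcε]
    exact Real.rpow_le_one_of_one_le_of_nonpos hn' (neg_nonpos.2 (by positivity)))
  have hcard : W.card ≤ n := by
    have h1 : ∑ σ ∈ W, (n : ℝ)⁻¹ ≤ 1 := by
      rw [← hWs]
      refine Finset.sum_le_sum fun σ hσ => ?_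
      have := Real.rpow_le_rpow (by rw [hcε]; exact hnd.le) (hWb σ hσ).1 hd0.le
      rwa [hcε, ← Real.rpow_mul hn0.le, neg_mul, one_div_mul_cancel hd0.ne',
        Real.rpow_neg_one] at this
    rw [Finset.sum_const, nsmul_eq_mul, ← div_eq_mul_inv, div_le_one hn0] at h1
    exact_mod_cast h1
  have hWne : W.Nonempty := let ⟨σ, hσ, _⟩ := hWE e he; ⟨σ, hσ⟩
  have hle : quantErr P n r ≤ ε := by
    refine quantErr_le_of_cover hPE hr (α := W.image fun σ => wordMap f σ e) (hWne.image _)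
      (Finset.card_image_le.trans hcard) hε.le fun x hx => ?_
    obtain ⟨σ, hσ, y, hy, rfl⟩ := hWE x hx
    refine ⟨_, Finset.mem_image_of_mem _ hσ, ?_⟩
    rw [dist_wordMap hf]
    refine (mul_le_mul (hWb σ hσ).2 ((Metric.dist_le_diam_of_mem hEcpt.isBounded hy he).trans
      hEdiam) dist_nonneg hε.le).trans (mul_one ε).le
  calc (n : ℝ) ^ (1 / d) * quantErr P n r ≤ (n : ℝ) ^ (1 / d) * ε := by gcongr
    _ = c⁻¹ := by
      rw [hεdef, mul_left_comm, ← Real.rpow_add hn0, add_neg_cancel, Real.rpow_zero, mul_one]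

theorem exists_le_quantErr {q : ℕ} {ν P : Measure (EuclideanSpace ℝ (Fin q))}
    [IsProbabilityMeasure ν] [IsFiniteMeasure P]
    {E : Set (EuclideanSpace ℝ (Fin q))} (hE : IsCompact E) (hPE : P Eᶜ = 0)
    {d : ℝ} (hd0 : 0 < d) {M : ℕ}
    (hM : ∀ x δ, 0 < δ → δ ≤ 1 → ν (Metric.closedBall x δ) ≤ ENNReal.ofReal (M * δ ^ d))
    {p₀ : ℝ} (hp₀ : 0 < p₀) (hle : ENNReal.ofReal p₀ • ν ≤ P) {r : ℝ} (hr : 0 < r) :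
    ∃ c : ℝ, 0 < c ∧ ∀ n : ℕ, 1 ≤ n → c ≤ (n : ℝ) ^ (1 / d) * quantErr P n r := by
  classical
  set K : ℝ := 2 * (M + 1) with hK
  have hK1 : 1 ≤ K := by
    have : (0 : ℝ) ≤ M := Nat.cast_nonneg M
    linarith
  have hK0 : 0 < K := by linarith
  refine ⟨K ^ (-(1 / d)) * (p₀ * (1 / 2)) ^ (1 / r), by positivity, fun n hn => ?_⟩
  have hn' : (1 : ℝ) ≤ n := by exact_mod_cast hn
  have hn0 : (0 : ℝ) < n := by linarith
  set δ : ℝ := (K * n) ^ (-(1 / d)) with hδdef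
  have hδ : 0 < δ := Real.rpow_pos_of_pos (mul_pos hK0 hn0) _
  have hδ1 : δ ≤ 1 :=
    Real.rpow_le_one_of_one_le_of_nonpos (one_le_mul_of_one_le_of_one_le hK1 hn')
      (neg_nonpos.2 (by positivity))
  have hδd : δ ^ d = (K * n)⁻¹ := by
    rw [hδdef, ← Real.rpow_mul (by positivity), neg_mul, one_div_mul_cancel hd0.ne',
      Real.rpow_neg_one]
  have hmass : ∀ α : Finset (EuclideanSpace ℝ (Fin q)), α.Nonempty → α.card ≤ n →
      p₀ * (1 / 2) ≤ P.real {x | δ ≤ Metric.infDist x (α : Set (EuclideanSpace ℝ (Fin q)))} := by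
    intro α hα hαn
    set S := {x | δ ≤ Metric.infDist x (α : Set (EuclideanSpace ℝ (Fin q)))}
    have hSm : MeasurableSet S :=
      (isClosed_le continuous_const (Metric.continuous_infDist_pt _)).measurableSet
    have hcompl : ν.real Sᶜ ≤ 1 / 2 := by
      have hsub : Sᶜ ⊆ ⋃ y ∈ α, Metric.closedBall y δ := by
        intro x hx
        have hx' : Metric.infDist x (α : Set (EuclideanSpace ℝ (Fin q))) < δ := not_le.1 hx
        obtain ⟨y, hy, hxy⟩ := (Metric.infDist_lt_iff (Finset.coe_nonempty.2 hα)).1 hx'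
        exact Set.mem_biUnion hy hxy.le
      have hball : ∀ y, ν.real (Metric.closedBall y δ) ≤ M * δ ^ d := fun y =>
        ENNReal.toReal_le_of_le_ofReal (by positivity) (hM y δ hδ hδ1)
      calc ν.real Sᶜ ≤ ν.real (⋃ y ∈ α, Metric.closedBall y δ) :=
          measureReal_mono hsub (measure_ne_top ν _)
        _ ≤ ∑ y ∈ α, ν.real (Metric.closedBall y δ) := measureReal_biUnion_finset_le _ _
        _ ≤ ∑ _y ∈ α, M * δ ^ d := Finset.sum_le_sum fun y _ => hball y
        _ = α.card * (M * δ ^ d) := by rw [Finset.sum_const, nsmul_eq_mul]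
        _ ≤ n * (M * δ ^ d) := by gcongr
        _ = M / K := by rw [hδd]; field_simp
        _ ≤ 1 / 2 := by rw [div_le_div_iff₀ hK0 two_pos]; linarith
    have hνS : 1 / 2 ≤ ν.real S := by
      have := probReal_compl_eq_one_sub (μ := ν) hSm
      linarith
    calc p₀ * (1 / 2) ≤ p₀ * ν.real S := by gcongr
      _ = (ENNReal.ofReal p₀ • ν).real S := by
        rw [measureReal_ennreal_smul_apply, ENNReal.toReal_ofReal hp₀.le]
      _ ≤ P.real S := ENNReal.toReal_mono (measure_ne_top P S) (hle S)
  have hmain := le_quantErr hE hPE hr hn hδ.le (by positivity) hmass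
  calc K ^ (-(1 / d)) * (p₀ * (1 / 2)) ^ (1 / r)
      = (n : ℝ) ^ (1 / d) * (δ * (p₀ * (1 / 2)) ^ (1 / r)) := by
        rw [hδdef, Real.mul_rpow hK0.le hn0.le, Real.rpow_neg hn0.le]
        have : (n : ℝ) ^ (1 / d) ≠ 0 := (Real.rpow_pos_of_pos hn0 _).ne'
        field_simp
    _ ≤ _ := by gcongr

theorem tendsto_log_div_neg_log {e : ℕ → ℝ} {d c C : ℝ} (hd : 0 < d) (hc : 0 < c)
    (hlow : ∀ n : ℕ, 1 ≤ n → c ≤ (n : ℝ) ^ (1 / d) * e n)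
    (hupp : ∀ n : ℕ, 1 ≤ n → (n : ℝ) ^ (1 / d) * e n ≤ C) :
    Tendsto (fun n : ℕ => Real.log n / (-Real.log (e n))) atTop (nhds d) := by
  have hlog : Tendsto (fun n : ℕ => Real.log n) atTop atTop :=
    Real.tendsto_log_atTop.comp tendsto_natCast_atTop_atTop
  have hsmall : Tendsto (fun n : ℕ => Real.log ((n : ℝ) ^ (1 / d) * e n) / Real.log n) atTop
      (nhds 0) := by
    refine tendsto_of_tendsto_of_tendsto_of_le_of_le'
      (hlog.const_div_atTop (Real.log c)) (hlog.const_div_atTop (Real.log C)) ?_ ?_ <;>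
    filter_upwards [eventually_ge_atTop 1] with n hn
    · exact div_le_div_of_nonneg_right (Real.log_le_log hc (hlow n hn)) (Real.log_natCast_nonneg n)
    · exact div_le_div_of_nonneg_right
        (Real.log_le_log (hc.trans_le (hlow n hn)) (hupp n hn)) (Real.log_natCast_nonneg n)
  have hinv := ((tendsto_const_nhds (x := 1 / d)).sub hsmall).inv₀
    (by rw [sub_zero]; positivity)
  rw [sub_zero, one_div d, inv_inv] at hinv
  refine hinv.congr' ?_
  filter_upwards [eventually_ge_atTop 2] with n hn
  have hn0 : (0 : ℝ) < n := by positivity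
  have hnd : 0 < (n : ℝ) ^ (1 / d) := Real.rpow_pos_of_pos hn0 _
  have hen : 0 < e n := pos_of_mul_pos_right (hc.trans_le (hlow n (by omega))) hnd.le
  have hlogn : 0 < Real.log n := Real.log_pos (by exact_mod_cast hn)
  rw [← one_div d, Real.log_mul hnd.ne' hen.ne', Real.log_rpow hn0, add_div,
    mul_div_cancel_right₀ _ hlogn.ne', sub_add_cancel_left, ← neg_div, inv_div]

/-- Corollary (Zhu): for the natural weights `t_i = s_i^{d_0}` (with `Σ s_i^{d_0} = 1`),
under the OSC the quantization dimension of `μ` of order `r` equals `d_0`, and the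
`d_0`-dimensional lower and upper quantization coefficients are positive and finite. -/
theorem quantization_for_natural_weights
    (q N : ℕ) (hq : 1 ≤ q) (hN : 2 ≤ N) (r : ℝ) (hr : 0 < r)
    (f : Fin N → EuclideanSpace ℝ (Fin q) → EuclideanSpace ℝ (Fin q))
    (s : Fin N → ℝ) (hs : ∀ i, s i ∈ Set.Ioo (0 : ℝ) 1)
    (hf : ∀ i x y, dist (f i x) (f i y) = s i * dist x y)
    (E : Set (EuclideanSpace ℝ (Fin q)))
    (hEcpt : IsCompact E) (hEne : E.Nonempty) (hEss : E = ⋃ i, f i '' E)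
    (hEdiam : Metric.diam E = 1)
    (hOSC : ∃ U : Set (EuclideanSpace ℝ (Fin q)), U.Nonempty ∧ IsOpen U ∧
      (∀ i, f i '' U ⊆ U) ∧ Pairwise fun i j => Disjoint (f i '' U) (f j '' U))
    (d0 : ℝ) (hd0 : 0 < d0) (hd0e : ∑ i, s i ^ d0 = 1)
    (t : Fin N → ℝ) (htdef : ∀ i, t i = s i ^ d0)
    (ν : Measure (EuclideanSpace ℝ (Fin q))) (hνP : IsProbabilityMeasure ν)
    (hνc : ∃ K, IsCompact K ∧ ν Kᶜ = 0)
    (hνss : ν = ∑ i, ENNReal.ofReal (t i) • ν.map (f i))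
    (p0 : ℝ) (p : Fin N → ℝ) (hp0 : 0 < p0) (hp : ∀ i, 0 < p i)
    (hp1 : p0 + ∑ i, p i = 1)
    (μ : Measure (EuclideanSpace ℝ (Fin q))) (hμP : IsProbabilityMeasure μ)
    (hμc : ∃ K, IsCompact K ∧ μ Kᶜ = 0)
    (hμss : μ = ENNReal.ofReal p0 • ν + ∑ i, ENNReal.ofReal (p i) • μ.map (f i)) :
    Tendsto (fun n : ℕ => Real.log n / (-Real.log (quantErr μ n r))) atTop (nhds d0) ∧
    0 < liminf (fun n : ℕ =>
      (((n : ℝ) ^ (1 / d0) * quantErr μ n r : ℝ) : EReal)) atTop ∧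
    limsup (fun n : ℕ =>
      (((n : ℝ) ^ (1 / d0) * quantErr μ n r : ℝ) : EReal)) atTop < ⊤ := by
  have hN0 : 0 < N := by omega
  have : Nonempty (Fin N) := ⟨⟨0, hN0⟩⟩
  obtain rfl : t = fun i => s i ^ d0 := funext htdef
  obtain ⟨U, hUne, hUo, hU, hUd⟩ := hOSC
  have hEmaps : ∀ i, Set.MapsTo (f i) E E := fun i x hx => by
    rw [hEss]
    exact Set.mem_iUnion.2 ⟨i, x, hx, rfl⟩
  have hνE : ν Eᶜ = 0 :=
    measure_compl_eq_zero_of_selfSimilar (m₀ := 0) hs hf hEcpt.isClosed hEne hEmaps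
      (fun i => Real.rpow_pos_of_pos (hs i).1 d0) hd0e.le (by simp) hνc (by rwa [zero_add])
  have hμE : μ Eᶜ = 0 :=
    measure_compl_eq_zero_of_selfSimilar hs hf hEcpt.isClosed hEne hEmaps hp (by linarith)
      (by rw [Measure.smul_apply, hνE, smul_zero]) hμc hμss
  obtain ⟨M, hM⟩ := exists_measure_closedBall_le hN0 hs hf hEcpt hEss.subset hUne hUo hU hUd hd0
    hd0e hνE hνss
  obtain ⟨c, hc, hlow⟩ := exists_le_quantErr hEcpt hμE hd0 hM hp0
    (hμss ▸ Measure.le_add_right le_rfl) hr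
  obtain ⟨C, -, hupp⟩ := exists_quantErr_le hN0 hs hf hEcpt hEne hEss.subset hEdiam.le hU hUd hd0
    hd0e hνss hμE hr
  refine ⟨tendsto_log_div_neg_log hd0 hc hlow hupp, ?_, ?_⟩
  · refine (EReal.coe_pos.2 hc).trans_le (le_liminf_of_le (by isBoundedDefault) ?_)
    filter_upwards [eventually_ge_atTop 1] with n hn
    exact EReal.coe_le_coe_iff.2 (hlow n hn)
  · refine (limsup_le_of_le (by isBoundedDefault) ?_).trans_lt (EReal.coe_lt_top C)
    filter_upwards [eventually_ge_atTop 1] with n hn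
    exact EReal.coe_le_coe_iff.2 (hupp n hn)
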